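/- For real numbers 0 ≤ a < b, the improper integral ∫₀^∞ e^{iat} J₁(bt) dt converges and equals (1/√(b² − a²)) · (√(1 − a²/b²) + i·(a/b)) · (1/1), i.e. it equals cos(arcsin(a/b))/√(b²−a²) + i sin(arcsin(a/b))/√(b²−a²) = (√(b²−a²) + i a) / (b √(b²−a²)). -/

import Mathlib

open Real MeasureTheory

/-- Bessel function of the first kind of integer order `n`. -/
noncomputable def besselJ (n : ℕ) (x : ℝ) : ℝ :=
  ∑' m : ℕ, (-1 : ℝ)^m / (m.factorial * (m+n).factorial) * (x/2)^(2*m+n)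

open Filter Topology

/-- The entire series `∑ (-y)^m / (m! (m+n)!)`, for which
`J_n(x) = (x/2)^n · besselSeries n (x²/4)`. -/
noncomputable def besselSeries (n : ℕ) (y : ℝ) : ℝ :=
  ∑' m : ℕ, (-1 : ℝ) ^ m / (m.factorial * (m + n).factorial) * y ^ m

lemma norm_besselSeries_coeff_le (n m : ℕ) :
    ‖(-1 : ℝ) ^ m / (m.factorial * (m + n).factorial)‖ ≤ 1 / m.factorial := by
  rw [norm_div, norm_pow, norm_neg, norm_one, one_pow, norm_mul, Real.norm_natCast,
    Real.norm_natCast]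
  have h : (1 : ℝ) ≤ (m + n).factorial := by exact_mod_cast Nat.factorial_pos _
  have h' : (0 : ℝ) < m.factorial := by exact_mod_cast Nat.factorial_pos _
  exact one_div_le_one_div_of_le h' (le_mul_of_one_le_right h'.le h)

lemma summable_besselSeries (n : ℕ) (y : ℝ) :
    Summable fun m : ℕ => (-1 : ℝ) ^ m / (m.factorial * (m + n).factorial) * y ^ m := by
  refine .of_norm_bounded (Real.summable_pow_div_factorial |y|) fun m => ?_
  rw [norm_mul, norm_pow, Real.norm_eq_abs y]
  exact (mul_le_mul_of_nonneg_right (norm_besselSeries_coeff_le n m) (by positivity)).trans_eq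
    (one_div_mul_eq_div _ _)

lemma hasDerivAt_besselSeries (n : ℕ) (y : ℝ) :
    HasDerivAt (besselSeries n) (-besselSeries (n + 1) y) y := by
  have hcoeff (m : ℕ) : (-1 : ℝ) ^ (m + 1) / ((m + 1).factorial * (m + 1 + n).factorial) *
      ((m + 1 : ℕ) * y ^ m) =
      -((-1 : ℝ) ^ m / (m.factorial * (m + (n + 1)).factorial) * y ^ m) := by
    rw [show m + 1 + n = m + (n + 1) by ring, Nat.factorial_succ m]
    have h : (m.factorial : ℝ) ≠ 0 := by exact_mod_cast Nat.factorial_ne_zero _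
    have h' : ((m + (n + 1)).factorial : ℝ) ≠ 0 := by exact_mod_cast Nat.factorial_ne_zero _
    have h1 : (m : ℝ) + 1 ≠ 0 := by positivity
    push_cast
    field_simp
    ring
  set r := |y| + 1
  have hu : Summable fun m : ℕ => (1 / (m.factorial : ℝ)) * (m * r ^ (m - 1)) := by
    rw [← summable_nat_add_iff 1]
    refine (Real.summable_pow_div_factorial r).congr fun m => ?_
    have h : (m.factorial : ℝ) ≠ 0 := by exact_mod_cast Nat.factorial_ne_zero _
    have h1 : (m : ℝ) + 1 ≠ 0 := by positivity
    rw [Nat.factorial_succ]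
    push_cast
    field_simp
  have hy : y ∈ Metric.ball (0 : ℝ) r := by
    rw [mem_ball_zero_iff, Real.norm_eq_abs]; exact lt_add_one _
  have hbound (m : ℕ) (x : ℝ) (hx : x ∈ Metric.ball (0 : ℝ) r) :
      ‖(-1 : ℝ) ^ m / (m.factorial * (m + n).factorial) * (m * x ^ (m - 1))‖ ≤
        (1 / (m.factorial : ℝ)) * (m * r ^ (m - 1)) := by
    rw [norm_mul, norm_mul, norm_pow, Real.norm_natCast]
    rw [mem_ball_zero_iff] at hx
    gcongr
    exact norm_besselSeries_coeff_le n m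
  have key := hasDerivAt_tsum_of_isPreconnected hu Metric.isOpen_ball
    (convex_ball (0 : ℝ) r).isPreconnected
    (fun m x _ => (hasDerivAt_pow m x).const_mul
      ((-1 : ℝ) ^ m / (m.factorial * (m + n).factorial))) hbound hy (summable_besselSeries n y) hy
  convert! key using 1
  rw [(Summable.of_norm_bounded hu fun m => hbound m y hy).tsum_eq_zero_add]
  simp only [Nat.add_sub_cancel, hcoeff, tsum_neg]
  simp [besselSeries]

lemma besselSeries_recurrence (n : ℕ) (y : ℝ) :
    besselSeries n y = (n + 1) * besselSeries (n + 1) y - y * besselSeries (n + 2) y := by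
  have h1 := (summable_besselSeries (n + 1) y).mul_left ((n : ℝ) + 1)
  have h2 := (summable_besselSeries (n + 2) y).mul_left y
  unfold besselSeries
  rw [← tsum_mul_left, ← tsum_mul_left, (summable_besselSeries n y).tsum_eq_zero_add,
    h1.tsum_eq_zero_add, add_sub_assoc, ← ((summable_nat_add_iff 1).2 h1).tsum_sub h2]
  congr 1
  · have h : ((n.factorial : ℕ) : ℝ) ≠ 0 := by exact_mod_cast Nat.factorial_ne_zero _
    have h1 : (n : ℝ) + 1 ≠ 0 := by positivity
    simp only [Nat.factorial_zero, zero_add, Nat.factorial_succ n]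
    push_cast
    field_simp
  · refine tsum_congr fun m => ?_
    rw [show m + 1 + (n + 1) = (m + n + 1) + 1 by ring, show m + (n + 2) = (m + n + 1) + 1 by ring,
      show m + 1 + n = m + n + 1 by ring, Nat.factorial_succ (m + n + 1), Nat.factorial_succ m]
    have h : (m.factorial : ℝ) ≠ 0 := by exact_mod_cast Nat.factorial_ne_zero _
    have h' : ((m + n + 1).factorial : ℝ) ≠ 0 := by exact_mod_cast Nat.factorial_ne_zero _
    have h1 : (m : ℝ) + 1 ≠ 0 := by positivity
    have h2 : (m : ℝ) + n + 1 + 1 ≠ 0 := by positivity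
    push_cast
    field_simp
    ring

lemma besselJ_eq (n : ℕ) (x : ℝ) : besselJ n x = (x / 2) ^ n * besselSeries n ((x / 2) ^ 2) := by
  unfold besselJ besselSeries
  rw [← tsum_mul_left]
  refine tsum_congr fun m => ?_
  rw [pow_add, pow_mul]
  ring

/-- The continuous extension of `J₁(x) / x` to the whole line. -/
noncomputable def besselJOneDiv (x : ℝ) : ℝ := besselSeries 1 ((x / 2) ^ 2) / 2

lemma besselJ_one_eq (x : ℝ) : besselJ 1 x = x * besselJOneDiv x := by
  rw [besselJ_eq, besselJOneDiv]; ring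

lemma hasDerivAt_besselSeries_sq (n : ℕ) (x : ℝ) :
    HasDerivAt (fun x => besselSeries n ((x / 2) ^ 2))
      (-(x / 2) * besselSeries (n + 1) ((x / 2) ^ 2)) x := by
  have h : HasDerivAt (fun x : ℝ => (x / 2) ^ 2) (x / 2) x := by
    convert! ((hasDerivAt_id x).div_const 2).pow 2 using 1
    simp; ring
  convert! (hasDerivAt_besselSeries n ((x / 2) ^ 2)).comp x h using 1
  ring

lemma hasDerivAt_besselJ_zero (x : ℝ) : HasDerivAt (besselJ 0) (-besselJ 1 x) x := by
  have h : besselJ 0 = fun x => besselSeries 0 ((x / 2) ^ 2) := by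
    funext x; simp [besselJ_eq]
  rw [h, besselJ_eq]
  convert! hasDerivAt_besselSeries_sq 0 x using 1
  simp

lemma hasDerivAt_besselJ_one (x : ℝ) :
    HasDerivAt (besselJ 1) (besselJ 0 x - besselJOneDiv x) x := by
  have h : besselJ 1 = fun x => x / 2 * besselSeries 1 ((x / 2) ^ 2) := by
    funext x; simp [besselJ_eq]
  rw [h, besselJ_eq, besselJOneDiv, besselSeries_recurrence 0]
  convert! ((hasDerivAt_id x).div_const 2).mul (hasDerivAt_besselSeries_sq 1 x) using 1
  simp
  ring

lemma continuous_besselJ_zero : Continuous (besselJ 0) :=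
  continuous_iff_continuousAt.2 fun x => (hasDerivAt_besselJ_zero x).continuousAt

lemma continuous_besselJ_one : Continuous (besselJ 1) :=
  continuous_iff_continuousAt.2 fun x => (hasDerivAt_besselJ_one x).continuousAt

lemma continuous_besselJOneDiv : Continuous besselJOneDiv :=
  (continuous_iff_continuousAt.2 fun x =>
    (hasDerivAt_besselSeries_sq 1 x).continuousAt).div_const 2

lemma besselJ_zero_zero : besselJ 0 0 = 1 := by
  rw [besselJ, tsum_eq_single 0 fun m hm => by simp [hm]]
  simp

lemma besselJ_one_zero : besselJ 1 0 = 0 := by simp [besselJ_one_eq]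

lemma besselJ_sq_add_sq_le_one {x : ℝ} (hx : 0 ≤ x) : besselJ 0 x ^ 2 + besselJ 1 x ^ 2 ≤ 1 := by
  have hder (x : ℝ) : HasDerivAt (fun x => besselJ 0 x ^ 2 + besselJ 1 x ^ 2)
      (-(2 * x * besselJOneDiv x ^ 2)) x := by
    convert! ((hasDerivAt_besselJ_zero x).pow 2).add ((hasDerivAt_besselJ_one x).pow 2) using 1
    simp [besselJ_one_eq]
    ring
  have hanti : AntitoneOn (fun x => besselJ 0 x ^ 2 + besselJ 1 x ^ 2) (Set.Ici 0) := by
    refine antitoneOn_of_hasDerivWithinAt_nonpos (convex_Ici 0)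
      (fun x _ => (hder x).continuousAt.continuousWithinAt)
      (fun x _ => (hder x).hasDerivWithinAt) fun x hx => ?_
    rw [interior_Ici, Set.mem_Ioi] at hx
    simp only [Left.neg_nonpos_iff]
    positivity
  simpa [besselJ_zero_zero, besselJ_one_zero] using hanti Set.self_mem_Ici hx hx

lemma abs_besselJ_one_le_one {x : ℝ} (hx : 0 ≤ x) : |besselJ 1 x| ≤ 1 :=
  abs_le_one_iff_mul_self_le_one.2 <| by
    nlinarith [besselJ_sq_add_sq_le_one hx, sq_nonneg (besselJ 0 x)]

lemma exists_besselJ_sq_add_sq_le_div :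
    ∃ C : ℝ, ∀ x : ℝ, 1 ≤ x → besselJ 0 x ^ 2 + besselJ 1 x ^ 2 ≤ C / x := by
  set E : ℝ → ℝ := fun x =>
    x * (besselJ 0 x ^ 2 + besselJ 1 x ^ 2) - besselJ 0 x * besselJ 1 x with hE
  have hlower (x : ℝ) (hx : 1 ≤ x) : x * (besselJ 0 x ^ 2 + besselJ 1 x ^ 2) ≤ 2 * E x := by
    simp only [hE]
    nlinarith [sq_nonneg (besselJ 0 x - besselJ 1 x), sq_nonneg (besselJ 0 x),
      sq_nonneg (besselJ 1 x)]
  have hder (x : ℝ) : HasDerivAt E (besselJ 0 x * besselJOneDiv x) x := by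
    have h0 := hasDerivAt_besselJ_zero x
    have h1 := hasDerivAt_besselJ_one x
    convert! ((hasDerivAt_id x).mul ((h0.pow 2).add (h1.pow 2))).sub (h0.mul h1) using 1
    simp [besselJ_one_eq]
    ring
  have hder' (x : ℝ) (hx : 1 ≤ x) : HasDerivAt (fun x => E x * rexp x⁻¹)
      ((besselJ 0 x * besselJOneDiv x - E x / x ^ 2) * rexp x⁻¹) x := by
    convert! (hder x).mul (hasDerivAt_inv (by positivity : x ≠ 0)).exp using 1
    ring
  have hanti : AntitoneOn (fun x => E x * rexp x⁻¹) (Set.Ici 1) := by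
    refine antitoneOn_of_hasDerivWithinAt_nonpos (convex_Ici 1)
      (fun x hx => (hder' x hx).continuousAt.continuousWithinAt)
      (fun x hx => (hder' x (interior_subset hx)).hasDerivWithinAt) fun x hx => ?_
    have hx1 : 1 ≤ x := interior_subset hx
    have hx0 : 0 < x := by linarith
    refine mul_nonpos_of_nonpos_of_nonneg ?_ (exp_pos _).le
    rw [sub_nonpos, le_div_iff₀ (by positivity)]
    have h := hlower x hx1
    rw [show besselJ 0 x * besselJOneDiv x * x ^ 2 = x * (besselJ 0 x * besselJ 1 x) by
      rw [besselJ_one_eq]; ring]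
    nlinarith [mul_nonneg hx0.le (sq_nonneg (besselJ 0 x - besselJ 1 x))]
  refine ⟨2 * (E 1 * rexp 1⁻¹), fun x hx => ?_⟩
  have hx0 : 0 < x := by linarith
  have hE0 : 0 ≤ E x := by
    have := hlower x hx
    have : 0 ≤ x * (besselJ 0 x ^ 2 + besselJ 1 x ^ 2) := by positivity
    linarith
  rw [le_div_iff₀ hx0, mul_comm]
  have h1 : E x * rexp x⁻¹ ≤ E 1 * rexp 1⁻¹ := hanti Set.self_mem_Ici hx hx
  have h2 : E x ≤ E x * rexp x⁻¹ :=
    le_mul_of_one_le_right hE0 (one_le_exp (by positivity))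
  exact (hlower x hx).trans (mul_le_mul_of_nonneg_left (h2.trans h1) zero_le_two)

lemma tendsto_zero_of_sq_le_div {f : ℝ → ℝ} {C : ℝ} (hf : ∀ x, 1 ≤ x → f x ^ 2 ≤ C / x) :
    Tendsto f atTop (𝓝 0) := by
  have h : Tendsto (fun x => f x ^ 2) atTop (𝓝 0) :=
    tendsto_of_tendsto_of_tendsto_of_le_of_le' tendsto_const_nhds
      (tendsto_const_nhds.div_atTop tendsto_id) (.of_forall fun x => sq_nonneg _)
      ((eventually_ge_atTop 1).mono hf)
  rw [tendsto_zero_iff_abs_tendsto_zero]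
  simpa [Function.comp_def, Real.sqrt_sq_eq_abs] using (Real.continuous_sqrt.tendsto 0).comp h

lemma tendsto_besselJ_zero_atTop : Tendsto (besselJ 0) atTop (𝓝 0) := by
  obtain ⟨C, hC⟩ := exists_besselJ_sq_add_sq_le_div
  exact tendsto_zero_of_sq_le_div fun x hx =>
    (le_add_of_nonneg_right (sq_nonneg _)).trans (hC x hx)

lemma tendsto_besselJ_one_atTop : Tendsto (besselJ 1) atTop (𝓝 0) := by
  obtain ⟨C, hC⟩ := exists_besselJ_sq_add_sq_le_div
  exact tendsto_zero_of_sq_le_div fun x hx =>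
    (le_add_of_nonneg_left (sq_nonneg _)).trans (hC x hx)

lemma integrableOn_besselJOneDiv : IntegrableOn besselJOneDiv (Set.Ioi 0) := by
  obtain ⟨C, hC⟩ := exists_besselJ_sq_add_sq_le_div
  rw [← Set.Ioc_union_Ioi_eq_Ioi zero_le_one, integrableOn_union]
  refine ⟨(continuous_besselJOneDiv.integrableOn_Icc (a := 0) (b := 1)).mono_set
    Set.Ioc_subset_Icc_self, ?_⟩
  refine Integrable.mono' ((integrableOn_Ioi_rpow_of_lt (a := -(3 / 2)) (by norm_num)
    zero_lt_one).const_mul √C) continuous_besselJOneDiv.aestronglyMeasurable ?_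
  filter_upwards [ae_restrict_mem measurableSet_Ioi] with x (hx : 1 < x)
  have hx0 : 0 < x := by linarith
  have h : |besselJ 1 x| ≤ √C / √x := by
    rw [← Real.sqrt_div' _ hx0.le]
    refine Real.abs_le_sqrt ?_
    exact (le_add_of_nonneg_left (sq_nonneg _)).trans (hC x hx.le)
  rw [show (-(3 / 2) : ℝ) = -(1 / 2) - 1 by norm_num, rpow_sub_one hx0.ne', rpow_neg hx0.le,
    ← Real.sqrt_eq_rpow, ← mul_div_assoc, ← div_eq_mul_inv, le_div_iff₀ hx0, Real.norm_eq_abs]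
  rwa [besselJ_one_eq, abs_mul, abs_of_pos hx0, mul_comm] at h

/-- The Laplace transform of `J₁(t) / t`. -/
noncomputable def laplaceBesselJOneDiv (z : ℂ) : ℂ :=
  ∫ t in Set.Ioi (0 : ℝ), Complex.exp (-z * t) * (besselJOneDiv t : ℂ)

lemma norm_cexp_neg_mul_ofReal (z : ℂ) (t : ℝ) :
    ‖Complex.exp (-z * t)‖ = rexp (-z.re * t) := by
  simp [Complex.norm_exp]

lemma norm_cexp_neg_mul_ofReal_le_one {z : ℂ} (hz : 0 ≤ z.re) {t : ℝ} (ht : 0 ≤ t) :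
    ‖Complex.exp (-z * t)‖ ≤ 1 := by
  rw [norm_cexp_neg_mul_ofReal, Real.exp_le_one_iff]
  nlinarith [mul_nonneg hz ht]

lemma continuous_cexp_neg_mul_ofReal (z : ℂ) : Continuous fun t : ℝ => Complex.exp (-z * t) := by
  fun_prop

lemma norm_cexp_mul_besselJOneDiv_le {z : ℂ} (hz : 0 ≤ z.re) {t : ℝ} (ht : 0 ≤ t) :
    ‖Complex.exp (-z * t) * (besselJOneDiv t : ℂ)‖ ≤ ‖besselJOneDiv t‖ := by
  rw [norm_mul, Complex.norm_real]
  exact mul_le_of_le_one_left (norm_nonneg _) (norm_cexp_neg_mul_ofReal_le_one hz ht)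

lemma continuous_cexp_mul_besselJOneDiv (z : ℂ) :
    Continuous fun t : ℝ => Complex.exp (-z * t) * (besselJOneDiv t : ℂ) :=
  (continuous_cexp_neg_mul_ofReal z).mul (Complex.continuous_ofReal.comp continuous_besselJOneDiv)

lemma continuous_cexp_mul_besselJ_one (z : ℂ) :
    Continuous fun t : ℝ => Complex.exp (-z * t) * (besselJ 1 t : ℂ) :=
  (continuous_cexp_neg_mul_ofReal z).mul (Complex.continuous_ofReal.comp continuous_besselJ_one)

lemma integrableOn_cexp_mul_besselJOneDiv {z : ℂ} (hz : 0 ≤ z.re) :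
    IntegrableOn (fun t : ℝ => Complex.exp (-z * t) * (besselJOneDiv t : ℂ)) (Set.Ioi 0) := by
  refine Integrable.mono' integrableOn_besselJOneDiv.norm
    (continuous_cexp_mul_besselJOneDiv z).aestronglyMeasurable ?_
  filter_upwards [ae_restrict_mem measurableSet_Ioi] with t ht
  exact norm_cexp_mul_besselJOneDiv_le hz (le_of_lt ht)

lemma norm_laplaceBesselJOneDiv_le {z : ℂ} (hz : 0 ≤ z.re) :
    ‖laplaceBesselJOneDiv z‖ ≤ ∫ t in Set.Ioi (0 : ℝ), ‖besselJOneDiv t‖ := by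
  refine norm_integral_le_of_norm_le integrableOn_besselJOneDiv.norm ?_
  filter_upwards [ae_restrict_mem measurableSet_Ioi] with t ht
  exact norm_cexp_mul_besselJOneDiv_le hz (le_of_lt ht)

lemma continuousOn_laplaceBesselJOneDiv :
    ContinuousOn laplaceBesselJOneDiv {z | 0 ≤ z.re} := by
  refine continuousOn_of_dominated (bound := fun t => ‖besselJOneDiv t‖)
    (fun z _ => (continuous_cexp_mul_besselJOneDiv z).aestronglyMeasurable) (fun z hz => ?_)
    integrableOn_besselJOneDiv.norm (.of_forall fun t => by fun_prop)
  filter_upwards [ae_restrict_mem measurableSet_Ioi] with t ht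
  exact norm_cexp_mul_besselJOneDiv_le hz (le_of_lt ht)

/-- Integration by parts using the first-order system satisfied by `J₀` and `J₁`. -/
lemma mul_integral_cexp_mul_besselJ_one (z : ℂ) (R : ℝ) :
    (1 + z ^ 2) * ∫ t in (0 : ℝ)..R, Complex.exp (-z * t) * (besselJ 1 t : ℂ) =
      1 - Complex.exp (-z * R) * (besselJ 0 R + z * besselJ 1 R) -
        z * ∫ t in (0 : ℝ)..R, Complex.exp (-z * t) * (besselJOneDiv t : ℂ) := by
  have hder (t : ℝ) : HasDerivAt
      (fun t : ℝ => -(Complex.exp (-z * t) * (besselJ 0 t + z * besselJ 1 t)))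
      ((1 + z ^ 2) * (Complex.exp (-z * t) * (besselJ 1 t : ℂ)) +
        z * (Complex.exp (-z * t) * (besselJOneDiv t : ℂ))) t := by
    have he : HasDerivAt (fun t : ℝ => Complex.exp (-z * t)) (Complex.exp (-z * t) * (-z)) t := by
      simpa using ((hasDerivAt_id t).ofReal_comp.const_mul (-z)).cexp
    have h0 := (hasDerivAt_besselJ_zero t).ofReal_comp
    have h1 := (hasDerivAt_besselJ_one t).ofReal_comp
    convert! (he.mul (h0.add (h1.const_mul z))).neg using 1
    simp only [Pi.add_apply]
    push_cast
    ring
  have hc1 := (continuous_cexp_mul_besselJ_one z).const_mul (1 + z ^ 2)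
  have hc2 := (continuous_cexp_mul_besselJOneDiv z).const_mul z
  have h := intervalIntegral.integral_eq_sub_of_hasDerivAt (a := 0) (b := R)
    (fun t _ => hder t) ((hc1.add hc2).intervalIntegrable _ _)
  rw [intervalIntegral.integral_add (hc1.intervalIntegrable _ _) (hc2.intervalIntegrable _ _),
    intervalIntegral.integral_const_mul, intervalIntegral.integral_const_mul] at h
  simp only [besselJ_zero_zero, besselJ_one_zero, Complex.ofReal_zero, mul_zero, Complex.exp_zero,
    Complex.ofReal_one, add_zero, mul_one] at h
  linear_combination h

lemma tendsto_integral_cexp_mul_besselJ_one {z : ℂ} (hz : 0 ≤ z.re) (hz' : 1 + z ^ 2 ≠ 0) :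
    Tendsto (fun R : ℝ => ∫ t in (0 : ℝ)..R, Complex.exp (-z * t) * (besselJ 1 t : ℂ)) atTop
      (𝓝 ((1 - z * laplaceBesselJOneDiv z) / (1 + z ^ 2))) := by
  have hJ : Tendsto (fun R : ℝ => (besselJ 0 R + z * besselJ 1 R : ℂ)) atTop (𝓝 0) := by
    simpa using
      ((Complex.continuous_ofReal.tendsto 0).comp tendsto_besselJ_zero_atTop).add
        (((Complex.continuous_ofReal.tendsto 0).comp tendsto_besselJ_one_atTop).const_mul z)
  have hb : Tendsto (fun R : ℝ => Complex.exp (-z * R) * (besselJ 0 R + z * besselJ 1 R)) atTop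
      (𝓝 0) := by
    refine squeeze_zero_norm' ?_ (tendsto_zero_iff_norm_tendsto_zero.1 hJ)
    filter_upwards [eventually_ge_atTop 0] with R hR
    rw [norm_mul]
    exact mul_le_of_le_one_left (norm_nonneg _) (norm_cexp_neg_mul_ofReal_le_one hz hR)
  have hK := intervalIntegral_tendsto_integral_Ioi 0 (integrableOn_cexp_mul_besselJOneDiv hz)
    tendsto_id
  have h := ((hb.const_sub 1).sub (hK.const_mul z)).div_const (1 + z ^ 2)
  rw [sub_zero] at h
  refine h.congr fun R => ?_
  rw [div_eq_iff hz', mul_comm _ (1 + z ^ 2), mul_integral_cexp_mul_besselJ_one]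
  rfl

lemma one_add_sq_mem_slitPlane {z : ℂ} (hz : 0 < z.re) : 1 + z ^ 2 ∈ Complex.slitPlane := by
  rw [Complex.mem_slitPlane_iff]
  by_cases h : z.im = 0
  · left
    simp [pow_two, h]
    positivity
  · right
    have him : (1 + z ^ 2).im = 2 * (z.re * z.im) := by simp [pow_two]; ring
    rw [him]
    exact mul_ne_zero two_ne_zero (mul_ne_zero hz.ne' h)

lemma hasDerivAt_laplaceBesselJOneDiv {z : ℂ} (hz : 0 < z.re) :
    HasDerivAt laplaceBesselJOneDiv
      (-((1 - z * laplaceBesselJOneDiv z) / (1 + z ^ 2))) z := by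
  have hs : {w : ℂ | z.re / 2 < w.re} ∈ 𝓝 z :=
    (isOpen_lt continuous_const Complex.continuous_re).mem_nhds (by simp; linarith)
  have hder (w : ℂ) (t : ℝ) : HasDerivAt
      (fun w : ℂ => Complex.exp (-w * t) * (besselJOneDiv t : ℂ))
      (-(Complex.exp (-w * t) * (besselJ 1 t : ℂ))) w := by
    convert! (((hasDerivAt_id w).neg.mul_const (t : ℂ)).cexp).mul_const (besselJOneDiv t : ℂ)
      using 1
    rw [besselJ_one_eq]
    push_cast
    simp
    ring
  obtain ⟨hint, h⟩ := hasDerivAt_integral_of_dominated_loc_of_deriv_le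
    (μ := volume.restrict (Set.Ioi (0 : ℝ)))
    (F := fun (w : ℂ) (t : ℝ) => Complex.exp (-w * t) * (besselJOneDiv t : ℂ))
    (F' := fun w t => -(Complex.exp (-w * t) * (besselJ 1 t : ℂ)))
    (bound := fun t => rexp (-(z.re / 2) * t)) hs
    (.of_forall fun w => (continuous_cexp_mul_besselJOneDiv w).aestronglyMeasurable)
    (integrableOn_cexp_mul_besselJOneDiv hz.le)
    (continuous_cexp_mul_besselJ_one z).neg.aestronglyMeasurable
    (by
      filter_upwards [ae_restrict_mem measurableSet_Ioi] with t (ht : 0 < t) w (hw : _ < _)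
      rw [norm_neg, norm_mul, norm_cexp_neg_mul_ofReal, Complex.norm_real, Real.norm_eq_abs]
      refine (mul_le_of_le_one_right (exp_pos _).le (abs_besselJ_one_le_one ht.le)).trans ?_
      gcongr)
    (exp_neg_integrableOn_Ioi 0 (half_pos hz))
    (.of_forall fun t w _ => hder w t)
  have hlim := (intervalIntegral_tendsto_integral_Ioi 0 hint tendsto_id).neg
  simp only [intervalIntegral.integral_neg, neg_neg, id] at hlim
  have huniq := tendsto_nhds_unique hlim (tendsto_integral_cexp_mul_besselJ_one hz.le
    (Complex.slitPlane_ne_zero (one_add_sq_mem_slitPlane hz)))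
  rw [← huniq, neg_neg]
  exact h

lemma hasDerivAt_one_add_sq_cpow {z : ℂ} (hz : 0 < z.re) :
    HasDerivAt (fun z : ℂ => (1 + z ^ 2) ^ (2⁻¹ : ℂ))
      (z * (1 + z ^ 2) ^ (2⁻¹ : ℂ) / (1 + z ^ 2)) z := by
  have hmem := one_add_sq_mem_slitPlane hz
  convert! (((hasDerivAt_pow 2 z).const_add 1).cpow_const (c := 2⁻¹) hmem) using 1
  rw [Complex.cpow_sub _ _ (Complex.slitPlane_ne_zero hmem), Complex.cpow_one]
  push_cast
  ring

lemma laplaceBesselJOneDiv_eq {z : ℂ} (hz : 0 < z.re) :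
    laplaceBesselJOneDiv z = (1 + z ^ 2) ^ (2⁻¹ : ℂ) - z := by
  set S : ℂ → ℂ := fun z => (1 + z ^ 2) ^ (2⁻¹ : ℂ)
  have hne {w : ℂ} (hw : 0 < w.re) : 1 + w ^ 2 ≠ 0 :=
    Complex.slitPlane_ne_zero (one_add_sq_mem_slitPlane hw)
  have hS (w : ℂ) : S w ^ 2 = 1 + w ^ 2 := by simp [S]
  have hS0 {w : ℂ} (hw : 0 < w.re) : S w ≠ 0 := fun h => hne hw (by rw [← hS, h]; simp)
  have hder {w : ℂ} (hw : 0 < w.re) :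
      HasDerivAt (fun z => (laplaceBesselJOneDiv z + z) / S z) 0 w := by
    convert! ((hasDerivAt_laplaceBesselJOneDiv hw).add (hasDerivAt_id w)).div
      (hasDerivAt_one_add_sq_cpow hw) (hS0 hw) using 1
    have := hne hw
    have := hS0 hw
    change 0 = ((-((1 - w * laplaceBesselJOneDiv w) / (1 + w ^ 2)) + 1) * S w -
      (laplaceBesselJOneDiv w + w) * (w * S w / (1 + w ^ 2))) / S w ^ 2
    field_simp
    ring
  obtain ⟨c, hc⟩ := (isOpen_lt continuous_const
      Complex.continuous_re).exists_is_const_of_deriv_eq_zero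
    (convex_halfSpace_re_gt 0).isPreconnected
    (fun w hw => (hder hw).differentiableAt.differentiableWithinAt)
    (fun w hw => (hder hw).deriv)
  have hcS {w : ℂ} (hw : 0 < w.re) : laplaceBesselJOneDiv w + w = c * S w :=
    (div_eq_iff (hS0 hw)).1 (hc w hw)
  suffices c = 1 by
    rw [eq_sub_iff_add_eq, hcS hz, this, one_mul]
  set M := ∫ t in Set.Ioi (0 : ℝ), ‖besselJOneDiv t‖
  have hSre (x : ℝ) : S x = (√(1 + x ^ 2) : ℝ) := by
    have h : (0 : ℝ) ≤ 1 + x ^ 2 := by positivity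
    simp only [S]
    rw [Real.sqrt_eq_rpow, Complex.ofReal_cpow h]
    push_cast
    norm_num
  have hbound (x : ℝ) (hx : 0 < x) : ‖c - 1‖ ≤ (M + 1) / x := by
    rw [le_div_iff₀ hx]
    have h1 : x ≤ √(1 + x ^ 2) := Real.le_sqrt_of_sq_le (by linarith)
    have h2 : √(1 + x ^ 2) ≤ x + 1 := Real.sqrt_le_iff.2 ⟨by linarith, by nlinarith⟩
    have hx' : 0 < (x : ℂ).re := by simpa
    calc ‖c - 1‖ * x ≤ ‖c - 1‖ * ‖S x‖ := by
          gcongr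
          rwa [hSre, Complex.norm_real, Real.norm_of_nonneg (Real.sqrt_nonneg _)]
      _ = ‖laplaceBesselJOneDiv x + (x - S x)‖ := by
          rw [← norm_mul]
          congr 1
          linear_combination -hcS hx'
      _ ≤ M + 1 := by
          refine (norm_add_le _ _).trans (add_le_add (norm_laplaceBesselJOneDiv_le hx'.le) ?_)
          rw [hSre, ← Complex.ofReal_sub, Complex.norm_real, Real.norm_eq_abs, abs_le]
          constructor <;> linarith
  have hlim : Tendsto (fun x : ℝ => (M + 1) / x) atTop (𝓝 0) :=
    tendsto_const_nhds.div_atTop tendsto_id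
  have hle : ‖c - 1‖ ≤ 0 := ge_of_tendsto hlim ((eventually_gt_atTop 0).mono hbound)
  exact sub_eq_zero.1 (norm_le_zero_iff.1 hle)

lemma laplaceBesselJOneDiv_neg_I_mul {α : ℝ} (hα : α ^ 2 < 1) :
    laplaceBesselJOneDiv (-(Complex.I * α)) = √(1 - α ^ 2) + Complex.I * α := by
  set p : ℝ → ℂ := fun x => x - Complex.I * α
  have hp : Continuous p := by fun_prop
  have hp0 : p 0 = -(Complex.I * α) := by simp [p]
  have hre (x : ℝ) : (p x).re = x := by simp [p]
  have hsq : 1 + p 0 ^ 2 = ((1 - α ^ 2 : ℝ) : ℂ) := by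
    rw [hp0, neg_sq, mul_pow, Complex.I_sq]; push_cast; ring
  have hmem : 1 + p 0 ^ 2 ∈ Complex.slitPlane := by
    rw [hsq, Complex.ofReal_mem_slitPlane]; linarith
  have hleft : Tendsto (fun x => laplaceBesselJOneDiv (p x)) (𝓝[>] 0)
      (𝓝 (laplaceBesselJOneDiv (p 0))) := by
    refine (continuousOn_laplaceBesselJOneDiv (p 0) (by simp [hre])).tendsto.comp ?_
    refine tendsto_nhdsWithin_iff.2 ⟨hp.continuousAt.tendsto.mono_left nhdsWithin_le_nhds, ?_⟩
    filter_upwards [self_mem_nhdsWithin] with x (hx : 0 < x)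
    simpa [hre] using hx.le
  have hright : Tendsto (fun x => (1 + p x ^ 2) ^ (2⁻¹ : ℂ) - p x) (𝓝[>] 0)
      (𝓝 ((1 + p 0 ^ 2) ^ (2⁻¹ : ℂ) - p 0)) := by
    have h : ContinuousAt (fun x => (1 + p x ^ 2) ^ (2⁻¹ : ℂ) - p x) 0 :=
      ((hp.pow 2).const_add 1).continuousAt.cpow continuousAt_const hmem |>.sub hp.continuousAt
    exact h.tendsto.mono_left nhdsWithin_le_nhds
  have h := tendsto_nhds_unique hleft (hright.congr' (by
    filter_upwards [self_mem_nhdsWithin] with x (hx : 0 < x)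
    exact (laplaceBesselJOneDiv_eq (by rwa [hre])).symm))
  rw [hsq, hp0] at h
  rw [h, Real.sqrt_eq_rpow, Complex.ofReal_cpow (by linarith)]
  push_cast
  norm_num

open Filter in
theorem stmt11 (a b : ℝ) (ha : 0 ≤ a) (hab : a < b) :
    Tendsto (fun R : ℝ => ∫ t in (0:ℝ)..R,
        Complex.exp (Complex.I * a * t) * (besselJ 1 (b * t) : ℂ))
      atTop (nhds ((((Real.sqrt (b^2 - a^2) : ℝ) : ℂ) + Complex.I * a) /
        ((b : ℂ) * ((Real.sqrt (b^2 - a^2) : ℝ) : ℂ)))) := by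
  have hb : 0 < b := ha.trans_lt hab
  have hbC : (b : ℂ) ≠ 0 := by exact_mod_cast hb.ne'
  have hpos : 0 < b ^ 2 - a ^ 2 := by nlinarith
  set α := a / b with hα
  set z : ℂ := -(Complex.I * α) with hz
  have hα1 : α ^ 2 < 1 := by
    rw [hα, div_pow, div_lt_one (by positivity)]; linarith
  have hz2 : 1 + z ^ 2 = ((1 - α ^ 2 : ℝ) : ℂ) := by
    rw [hz, neg_sq, mul_pow, Complex.I_sq]; push_cast; ring
  have hz0 : 1 + z ^ 2 ≠ 0 := by
    rw [hz2]; exact_mod_cast (by linarith : 1 - α ^ 2 ≠ 0)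
  have hlim := ((tendsto_integral_cexp_mul_besselJ_one (z := z) (by simp [hz]) hz0).comp
    (tendsto_id.const_mul_atTop hb)).const_mul ((b : ℂ)⁻¹)
  have hval : (b : ℂ)⁻¹ * ((1 - z * laplaceBesselJOneDiv z) / (1 + z ^ 2)) =
      (((Real.sqrt (b^2 - a^2) : ℝ) : ℂ) + Complex.I * a) /
        ((b : ℂ) * ((Real.sqrt (b^2 - a^2) : ℝ) : ℂ)) := by
    have hs : √(1 - α ^ 2) = √(b ^ 2 - a ^ 2) / b := by
      rw [hα, show 1 - (a / b) ^ 2 = (b ^ 2 - a ^ 2) / b ^ 2 by field_simp,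
        Real.sqrt_div' _ (by positivity), Real.sqrt_sq hb.le]
    have hs2 : ((√(b ^ 2 - a ^ 2) : ℝ) : ℂ) ^ 2 = b ^ 2 - a ^ 2 := by
      exact_mod_cast Real.sq_sqrt hpos.le
    have hs0 : ((√(b ^ 2 - a ^ 2) : ℝ) : ℂ) ≠ 0 := by
      exact_mod_cast (Real.sqrt_pos.2 hpos).ne'
    have hz2' : 1 + z ^ 2 = ((√(b ^ 2 - a ^ 2) : ℝ) : ℂ) ^ 2 / b ^ 2 := by
      rw [hz2, hs2, hα]; push_cast; field_simp
    rw [hz2', laplaceBesselJOneDiv_neg_I_mul hα1, hs, hz, hα]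
    push_cast
    field_simp
    ring_nf
    simp only [Complex.I_sq]
    linear_combination -hs2
  rw [hval] at hlim
  refine hlim.congr fun R => ?_
  have h := intervalIntegral.integral_comp_mul_left (a := 0) (b := R)
    (fun u : ℝ => Complex.exp (-z * u) * (besselJ 1 u : ℂ)) hb.ne'
  rw [mul_zero, Complex.real_smul, Complex.ofReal_inv] at h
  simp only [Function.comp_apply, id]
  rw [← h]
  refine intervalIntegral.integral_congr fun t _ => ?_
  have harg : -z * ((b * t : ℝ) : ℂ) = Complex.I * a * t := by
    rw [hz, hα]; push_cast; field_simp
  simp only [harg]
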